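/- The unimodal order ≤_uni on {0,1}^∞ is a cylinder order whose smallest accumulation point m_uni := m_{≤_uni} equals τ_{0,1}(m_alt), which is the fixed point 10111010101110111011101010111010⋯ of the period-doubling substitution 0 ↦ 11, 1 ↦ 10. -/

import Mathlib

open scoped Classical

noncomputable section

/-- The ultrametric on infinite words: `d(a,b) = 2^{-min{n ≥ 1 : a_n ≠ b_n}}`
(words are indexed from 0 here, so position `i` corresponds to `n = i+1`). -/
noncomputable def wdist {A : Type*} [DecidableEq A] (a b : ℕ → A) : ℝ :=
  if h : ∃ n, a n ≠ b n then (2 : ℝ)⁻¹ ^ (Nat.find h + 1) else 0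

/-- The tail `a_{k+1} a_{k+2} ⋯` of an infinite word. -/
def shiftn {A : Type*} (a : ℕ → A) (k : ℕ) : ℕ → A := fun n => a (n + k)

/-- The set of tails of an infinite word (including the word itself). -/
def tails {A : Type*} (a : ℕ → A) : Set (ℕ → A) := {b | ∃ k, b = shiftn a k}

/-- A cylinder order: a total order such that `a ≤ b ≤ c` implies `d(a,b) ≤ d(a,c)`. -/
def IsCylOrder {A : Type*} [DecidableEq A] (le : (ℕ → A) → (ℕ → A) → Prop) : Prop :=
  (∀ a b, le a b ∨ le b a) ∧
  (∀ a b, le a b → le b a → a = b) ∧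
  (∀ a b c, le a b → le b c → le a c) ∧
  (∀ a b c, le a b → le b c → wdist a b ≤ wdist a c)

/-- Strict comparison associated to an order relation. -/
def wlt {A : Type*} (le : (ℕ → A) → (ℕ → A) → Prop) (a b : ℕ → A) : Prop :=
  le a b ∧ a ≠ b

/-- `m` is the least upper bound of the set `s` with respect to `le`. -/
def IsSupOf {A : Type*} (le : (ℕ → A) → (ℕ → A) → Prop) (s : Set (ℕ → A))
    (m : ℕ → A) : Prop :=
  (∀ x ∈ s, le x m) ∧ ∀ b, (∀ x ∈ s, le x b) → le m b

/-- The set `M_≤ = {s_≤(a) : a ∈ A^∞}` of sup-words. -/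
def supWords {A : Type*} (le : (ℕ → A) → (ℕ → A) → Prop) : Set (ℕ → A) :=
  {m | ∃ a, IsSupOf le (tails a) m}

/-- `x` is an accumulation point of `M` in the metric `wdist`. -/
def IsAccPt' {A : Type*} [DecidableEq A] (M : Set (ℕ → A)) (x : ℕ → A) : Prop :=
  ∀ ε : ℝ, 0 < ε → ∃ y ∈ M, y ≠ x ∧ wdist x y < ε

/-- `x` is the smallest (w.r.t. `le`) accumulation point of `M`. -/
def IsSmallestAcc {A : Type*} [DecidableEq A] (le : (ℕ → A) → (ℕ → A) → Prop)
    (M : Set (ℕ → A)) (x : ℕ → A) : Prop :=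
  IsAccPt' M x ∧ ∀ y, IsAccPt' M y → le x y

/-- Membership in the cylinder given by the finite word `w`. -/
def inCyl {A : Type*} (w : List A) (a : ℕ → A) : Prop :=
  ∀ i : Fin w.length, a i.val = w.get i

/-- `[u] < [v]` for cylinders: every element of `[u]` is strictly below every element of `[v]`. -/
def cylLt {A : Type*} (le : (ℕ → A) → (ℕ → A) → Prop) (u v : List A) : Prop :=
  ∀ a b, inCyl u a → inCyl v b → wlt le a b

/-- Infinite binary words. -/
abbrev W2 := ℕ → Bool

/-- The word `0^∞`. -/
def w0 : W2 := fun _ => false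

/-- The word `1^∞`. -/
def w1 : W2 := fun _ => true

/-- The word `10^∞`. -/
def w10inf : W2 := fun n => decide (n = 0)

/-- The periodic word `w^∞` for a finite word `w`. -/
def perW (w : List Bool) : W2 := fun n => w.getD (n % w.length) false

/-- A substitution on `{0,1}`, given by the images of the two letters. -/
abbrev Sub2 := Bool → List Bool

/-- Action of a substitution on finite words. -/
def listApply (f : Sub2) (l : List Bool) : List Bool := (l.map f).flatten

/-- Action of a (nonerasing) substitution on infinite words. -/
def subApply (f : Sub2) (a : W2) : W2 :=
  fun n => (listApply f (List.ofFn (fun i : Fin (n + 1) => a i.val))).getD n false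

/-- The substitution `τ_{j,k} : 0 ↦ 10^j, 1 ↦ 10^k`. -/
def tauS (j k : ℕ) : Sub2 := fun b => true :: List.replicate (if b then k else j) false

/-- Membership in the set `S = {τ_{j,k} : 0 ≤ j < k}`. -/
def memS (f : Sub2) : Prop := ∃ j k : ℕ, j < k ∧ f = tauS j k

/-- Apply a finite composition `σ_1 ∘ ⋯ ∘ σ_n` (given as a list) to an infinite word. -/
def applyList (L : List Sub2) (a : W2) : W2 := L.foldr subApply a

/-- Apply a finite composition `σ_1 ∘ ⋯ ∘ σ_n` (given as a list) to a finite word. -/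
def listApplyL (L : List Sub2) (l : List Bool) : List Bool := L.foldr listApply l

/-- `σ_{[1,n]} = σ_1 ∘ ⋯ ∘ σ_n` applied to an infinite word, for `σ ∈ S^∞`
(indexed from 0 in Lean). -/
def compUpTo (σ : ℕ → Sub2) (n : ℕ) (a : W2) : W2 :=
  applyList (List.ofFn (fun i : Fin n => σ i.val)) a

/-- `m` is the limit word `lim_{n → ∞} σ_{[1,n]}(a)`. -/
def IsLimitWord (σ : ℕ → Sub2) (a m : W2) : Prop :=
  ∀ ε : ℝ, 0 < ε → ∃ N : ℕ, ∀ n ≥ N, wdist (compUpTo σ n a) m < ε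

/-- Strict alternating lexicographic order on `{0,1}^∞`: at the first differing position
`i` (0-indexed, so the paper's index `n = i+1`), `a <_alt b` iff `a_i < b_i` and `i+1` is
odd (i.e. `i` even), or `a_i > b_i` and `i+1` is even (i.e. `i` odd). -/
def altLt (a b : W2) : Prop :=
  ∃ i : ℕ, (∀ m < i, a m = b m) ∧
    (if Even i then a i = false ∧ b i = true else a i = true ∧ b i = false)

/-- The alternating lexicographic order on `{0,1}^∞`. -/
def altLe (a b : W2) : Prop := a = b ∨ altLt a b

/-- Strict unimodal order on `{0,1}^∞`: at the first differing position `i`,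
`a <_uni b` iff `a_i < b_i` and the number of 1's among `a_0 ⋯ a_{i-1}` is even,
or `a_i > b_i` and that number is odd. -/
def uniLt (a b : W2) : Prop :=
  ∃ i : ℕ, (∀ m < i, a m = b m) ∧
    (if Even ((List.range i).countP (fun m => a m)) then a i = false ∧ b i = true
      else a i = true ∧ b i = false)

/-- The unimodal order on `{0,1}^∞`. -/
def uniLe (a b : W2) : Prop := a = b ∨ uniLt a b

/-- The period-doubling (Feigenbaum) substitution `0 ↦ 11, 1 ↦ 10`. -/
def pdSub : Sub2 := fun b => if b then [true, false] else [true, true]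

/-! ### Prefixes and the ultrametric -/

/-- The words `a` and `b` have the same prefix of length `n`. -/
def Agree {A : Type*} (n : ℕ) (a b : ℕ → A) : Prop := ∀ i < n, a i = b i

theorem exists_agree_ne {A : Type*} {a b : ℕ → A} (h : a ≠ b) :
    ∃ n, Agree n a b ∧ a n ≠ b n := by
  have h' : ∃ n, a n ≠ b n := by
    by_contra! hc
    exact h (funext hc)
  exact ⟨Nat.find h', fun i hi => not_not.1 (Nat.find_min h' hi), Nat.find_spec h'⟩

theorem wdist_eq {A : Type*} [DecidableEq A] {a b : ℕ → A} {n : ℕ}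
    (h : Agree n a b) (hn : a n ≠ b n) : wdist a b = (2 : ℝ)⁻¹ ^ (n + 1) := by
  have h' : ∃ n, a n ≠ b n := ⟨n, hn⟩
  have hf : Nat.find h' = n :=
    (Nat.find_eq_iff h').2 ⟨hn, fun i hi => not_not.2 (h i hi)⟩
  simp only [wdist, dif_pos h', hf]

theorem wdist_self {A : Type*} [DecidableEq A] (a : ℕ → A) : wdist a a = 0 := by
  simp [wdist]

theorem wdist_nonneg {A : Type*} [DecidableEq A] (a b : ℕ → A) : 0 ≤ wdist a b := by
  unfold wdist
  split_ifs <;> positivity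

theorem wdist_lt_iff {A : Type*} [DecidableEq A] {a b : ℕ → A} {n : ℕ} :
    wdist a b < (2 : ℝ)⁻¹ ^ n ↔ Agree n a b := by
  by_cases hab : a = b
  · subst hab
    simp [wdist_self, Agree]
  · obtain ⟨k, hk, hne⟩ := exists_agree_ne hab
    rw [wdist_eq hk hne, pow_lt_pow_iff_right_of_lt_one₀ (by norm_num) (by norm_num)]
    constructor
    · intro h i hi
      exact hk i (by omega)
    · intro h
      by_contra! hc
      exact hne (h k (by omega))

theorem wdist_le_of_agree {A : Type*} [DecidableEq A] {a b c : ℕ → A}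
    (h : ∀ n, Agree n a c → Agree n a b) : wdist a b ≤ wdist a c := by
  by_cases hac : a = c
  · have : a = b := funext fun n => h (n + 1) (fun i _ => by rw [hac]) n (by omega)
    rw [← this, wdist_self]
    exact wdist_nonneg _ _
  · obtain ⟨k, hk, hne⟩ := exists_agree_ne hac
    rw [wdist_eq hk hne]
    by_contra! hc
    by_cases hab : a = b
    · rw [← hab, wdist_self] at hc
      exact absurd hc (not_lt.2 (by positivity))
    · obtain ⟨l, hl, hne'⟩ := exists_agree_ne hab
      rw [wdist_eq hl hne', pow_lt_pow_iff_right_of_lt_one₀ (by norm_num) (by norm_num)] at hc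
      exact hne' (h k hk l (by omega))

theorem isAccPt'_iff {A : Type*} [DecidableEq A] {M : Set (ℕ → A)} {x : ℕ → A} :
    IsAccPt' M x ↔ ∀ n, ∃ y ∈ M, y ≠ x ∧ Agree n x y := by
  constructor
  · intro h n
    obtain ⟨y, hy, hne, hd⟩ := h ((2 : ℝ)⁻¹ ^ n) (by positivity)
    exact ⟨y, hy, hne, wdist_lt_iff.1 hd⟩
  · intro h ε hε
    obtain ⟨n, hn⟩ := exists_pow_lt_of_lt_one hε (show (2 : ℝ)⁻¹ < 1 by norm_num)
    obtain ⟨y, hy, hne, hd⟩ := h n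
    exact ⟨y, hy, hne, (wdist_lt_iff.2 hd).trans hn⟩

/-! ### Orders that become lexicographic after recoding -/

/-- `κ` is a prefix-preserving recoding of words which turns `le` into the
lexicographic order. -/
structure IsLexCoding (le : W2 → W2 → Prop) (κ : W2 → W2) : Prop where
  surjective : Function.Surjective κ
  agree_iff : ∀ a b n, Agree n (κ a) (κ b) ↔ Agree n a b
  le_iff : ∀ a b, le a b ↔ toLex (κ a) ≤ toLex (κ b)

namespace IsLexCoding

variable {le : W2 → W2 → Prop} {κ : W2 → W2}

theorem injective (h : IsLexCoding le κ) : Function.Injective κ := by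
  intro a b hab
  funext n
  exact (h.agree_iff a b (n + 1)).1 (fun i _ => by rw [hab]) n (by omega)

theorem total (h : IsLexCoding le κ) (a b : W2) : le a b ∨ le b a := by
  rw [h.le_iff, h.le_iff]
  exact le_total _ _

theorem antisymm (h : IsLexCoding le κ) {a b : W2} (hab : le a b) (hba : le b a) : a = b := by
  rw [h.le_iff] at hab hba
  exact h.injective (toLex.injective (le_antisymm hab hba))

theorem trans (h : IsLexCoding le κ) {a b c : W2} (hab : le a b) (hbc : le b c) : le a c := by
  rw [h.le_iff] at *
  exact hab.trans hbc

theorem exists_of_le_of_ne (h : IsLexCoding le κ) {a b : W2} (hab : le a b) (hne : a ≠ b) :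
    ∃ n, Agree n (κ a) (κ b) ∧ κ a n = false ∧ κ b n = true := by
  rw [h.le_iff] at hab
  have hlt : toLex (κ a) < toLex (κ b) :=
    lt_of_le_of_ne hab fun he => hne (h.injective (toLex.injective he))
  obtain ⟨n, hn, hlt⟩ := hlt
  exact ⟨n, hn, Bool.lt_iff.1 hlt⟩

theorem le_of_agree (h : IsLexCoding le κ) {a b : W2} {n : ℕ} (hn : Agree n (κ a) (κ b))
    (ha : κ a n = false) (hb : κ b n = true) : le a b := by
  rw [h.le_iff]
  exact le_of_lt ⟨n, hn, Bool.lt_iff.2 ⟨ha, hb⟩⟩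

theorem isCylOrder (h : IsLexCoding le κ) : IsCylOrder le := by
  refine ⟨h.total, fun _ _ => h.antisymm, fun _ _ _ => h.trans, fun a b c hab hbc => ?_⟩
  refine wdist_le_of_agree fun n hac => ?_
  by_contra hn
  have hne : a ≠ b := fun he => hn (fun i _ => by rw [he])
  obtain ⟨k, hk, hka, hkb⟩ := h.exists_of_le_of_ne hab hne
  have hkn : k < n := by
    by_contra! hc
    exact hn fun i hi => (h.agree_iff a b k).1 hk i (by omega)
  have hac' := (h.agree_iff a c n).2 hac
  have hcb : le c b := h.le_of_agree (n := k)
    (fun i hi => (hac' i (by omega)).symm.trans (hk i hi)) ((hac' k hkn).symm.trans hka) hkb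
  have := h.antisymm hbc hcb
  rw [this] at hkb
  rw [hac' k hkn, hkb] at hka
  exact Bool.noConfusion hka

/-- The least upper bound of a nonempty set lies in its closure. -/
theorem exists_agree_of_isSupOf (h : IsLexCoding le κ) {s : Set W2} {m : W2}
    (hs : s.Nonempty) (hm : IsSupOf le s m) (n : ℕ) : ∃ x ∈ s, Agree n x m := by
  induction n with
  | zero =>
    obtain ⟨x, hx⟩ := hs
    exact ⟨x, hx, fun i hi => absurd hi (by omega)⟩
  | succ n ih =>
    by_contra! hc
    have key : ∀ x ∈ s, Agree n (κ x) (κ m) → κ x n = false ∧ κ m n = true := by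
      intro x hx hxn
      have hne : x ≠ m := fun he => hc x hx (fun i _ => by rw [he])
      obtain ⟨k, hk, hkx, hkm⟩ := h.exists_of_le_of_ne (hm.1 x hx) hne
      rcases lt_trichotomy k n with hkn | hkn | hkn
      · rw [hxn k hkn, hkm] at hkx
        exact Bool.noConfusion hkx
      · exact hkn ▸ ⟨hkx, hkm⟩
      · exact absurd (fun i hi => (h.agree_iff x m k).1 hk i (by omega)) (hc x hx)
    obtain ⟨b, hb⟩ := h.surjective
      (fun i => if i < n then κ m i else if i = n then false else true)
    have hbm : Agree n (κ b) (κ m) := fun i hi => by simp [hb, hi]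
    have hbn : κ b n = false := by simp [hb]
    have hbt : ∀ i, n < i → κ b i = true := fun i hi => by
      simp [hb, hi.ne', not_lt.2 hi.le]
    obtain ⟨y, hy, hyn⟩ := ih
    have hmn : κ m n = true := (key y hy ((h.agree_iff _ _ _).2 hyn)).2
    have hle : le m b := by
      refine hm.2 b fun x hx => ?_
      by_cases hxb : x = b
      · rw [h.le_iff, hxb]
      rcases h.total x b with hxb' | hbx
      · exact hxb'
      obtain ⟨k, hk, hkb, hkx⟩ := h.exists_of_le_of_ne hbx (Ne.symm hxb)
      rcases lt_trichotomy k n with hkn | hkn | hkn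
      · have hmx : le m x := h.le_of_agree (n := k)
          (fun i hi => (hbm i (by omega)).symm.trans (hk i hi))
          ((hbm k hkn).symm.trans hkb) hkx
        have hxm := h.antisymm hmx (hm.1 x hx)
        rw [← hxm, ← hbm k hkn, hkb] at hkx
        exact Bool.noConfusion hkx
      · subst hkn
        have := (key x hx fun i hi => (hk i hi).symm.trans (hbm i hi)).1
        rw [hkx] at this
        exact Bool.noConfusion this
      · rw [hbt k hkn] at hkb
        exact Bool.noConfusion hkb
    have hmb := h.antisymm hle (h.le_of_agree hbm hbn hmn)
    rw [hmb, hbn] at hmn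
    exact Bool.noConfusion hmn

theorem mem_supWords_iff (h : IsLexCoding le κ) {s : W2} :
    s ∈ supWords le ↔ ∀ k, le (shiftn s k) s := by
  constructor
  · rintro ⟨a, ha⟩ k
    by_cases hks : shiftn s k = s
    · rw [h.le_iff, hks]
    rcases h.total (shiftn s k) s with hle | hle
    · exact hle
    obtain ⟨n, hn, hns, hnk⟩ := h.exists_of_le_of_ne hle (Ne.symm hks)
    obtain ⟨x, ⟨j, rfl⟩, hx⟩ :=
      h.exists_agree_of_isSupOf (s := tails a) ⟨a, 0, rfl⟩ ha (n + 1 + k)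
    have hsh : Agree (n + 1) (shiftn a (k + j)) (shiftn s k) := fun i hi => by
      have := hx (i + k) (by omega)
      simpa [shiftn, add_assoc] using this
    have hsh' := (h.agree_iff _ _ _).2 hsh
    have hlt : le s (shiftn a (k + j)) := h.le_of_agree (n := n)
      (fun i hi => (hn i hi).trans (hsh' i (by omega)).symm) hns
      ((hsh' n (by omega)).trans hnk)
    have heq := h.antisymm hlt (ha.1 _ ⟨k + j, rfl⟩)
    rw [← heq] at hsh'
    have := hsh' n (by omega)
    rw [hnk, hns] at this
    exact Bool.noConfusion this
  · intro hs
    refine ⟨s, ?_, fun b hb => hb s ⟨0, rfl⟩⟩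
    rintro x ⟨k, rfl⟩
    exact hs k

end IsLexCoding

/-! ### The alternating and unimodal orders -/

/-- Flips the letters at odd positions. -/
def altCode (a : W2) : W2 := fun n => xor (a n) (decide (Odd n))

/-- The parities of the number of ones in the nonempty prefixes. -/
def uniCode (a : W2) : W2 :=
  fun n => xor (a n) (decide (Odd ((List.range n).countP (fun m => a m))))

theorem countP_range_congr {a b : W2} {n : ℕ} (h : Agree n a b) :
    (List.range n).countP (fun m => a m) = (List.range n).countP (fun m => b m) :=
  List.countP_congr fun i hi => by rw [h i (List.mem_range.1 hi)]

theorem countP_range_succ (a : W2) (n : ℕ) :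
    (List.range (n + 1)).countP (fun m => a m) =
      (List.range n).countP (fun m => a m) + (a n).toNat := by
  rw [List.range_succ, List.countP_append]
  cases h : a n <;> simp [h]

theorem uniCode_zero (a : W2) : uniCode a 0 = a 0 := by
  simp [uniCode]

theorem uniCode_succ (a : W2) (n : ℕ) : uniCode a (n + 1) = xor (a (n + 1)) (uniCode a n) := by
  unfold uniCode
  rw [countP_range_succ]
  cases h : a n <;> by_cases ho : Odd ((List.range n).countP (fun m => a m)) <;>
    simp [ho, Nat.odd_add_one]

theorem isLexCoding_of_code {le lt : W2 → W2 → Prop} {κ : W2 → W2}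
    (hle : ∀ a b, le a b ↔ a = b ∨ lt a b) (hsurj : Function.Surjective κ)
    (hκ : ∀ a b n, Agree n a b → (κ a n = κ b n ↔ a n = b n))
    (hlt : ∀ a b, lt a b ↔ ∃ n, Agree n a b ∧ κ a n = false ∧ κ b n = true) :
    IsLexCoding le κ := by
  have hag : ∀ a b n, Agree n (κ a) (κ b) ↔ Agree n a b := by
    intro a b n
    constructor
    · intro h i
      induction i using Nat.strong_induction_on with
      | _ i ih =>
        intro hi
        exact (hκ a b i fun j hj => ih j hj (by omega)).1 (h i hi)
    · intro h i hi
      exact (hκ a b i fun j hj => h j (by omega)).2 (h i hi)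
  refine ⟨hsurj, hag, fun a b => ?_⟩
  rw [hle, hlt, le_iff_eq_or_lt]
  refine or_congr ⟨fun h => by rw [h], fun h => ?_⟩ (exists_congr fun n => ?_)
  · have h' := toLex.injective h
    funext n
    exact (hag a b (n + 1)).1 (fun i _ => by rw [h']) n (by omega)
  · exact and_congr (hag a b n).symm Bool.lt_iff.symm

theorem isLexCoding_alt : IsLexCoding altLe altCode := by
  refine isLexCoding_of_code (lt := altLt) (fun _ _ => Iff.rfl) ?_ ?_ ?_
  · exact fun w => ⟨altCode w, by funext n; simp [altCode]⟩
  · intro a b n _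
    simp [altCode]
  · intro a b
    refine exists_congr fun n => and_congr Iff.rfl ?_
    by_cases h : Even n
    · simp [altCode, h, Nat.not_odd_iff_even.2 h]
    · simp [altCode, h, Nat.not_even_iff_odd.1 h]

theorem isLexCoding_uni : IsLexCoding uniLe uniCode := by
  refine isLexCoding_of_code (lt := uniLt) (fun _ _ => Iff.rfl) ?_ ?_ ?_
  · intro w
    refine ⟨fun n => Nat.casesOn n (w 0) fun n => xor (w (n + 1)) (w n), ?_⟩
    funext n
    induction n with
    | zero => simp [uniCode_zero]
    | succ n ih => simp [uniCode_succ, ih]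
  · intro a b n h
    simp [uniCode, countP_range_congr h]
  · intro a b
    refine exists_congr fun n => and_congr_right fun hab => ?_
    have hc := countP_range_congr hab
    by_cases h : Even ((List.range n).countP (fun m => a m))
    · simp [uniCode, h, ← hc, Nat.not_odd_iff_even.2 h]
    · simp [uniCode, h, ← hc, Nat.not_even_iff_odd.1 h]

theorem uniLt_of_zero {a b : W2} (ha : a 0 = false) (hb : b 0 = true) : uniLt a b :=
  ⟨0, fun i hi => absurd hi (by omega), by simp [ha, hb]⟩

theorem uniLt_irrefl (a : W2) : ¬ uniLt a a := by
  rintro ⟨n, -, h⟩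
  split_ifs at h <;> rw [h.1] at h <;> exact Bool.noConfusion h.2

theorem uniLt.not_uniLe {a b : W2} (h : uniLt a b) : ¬ uniLe b a := by
  intro hba
  have := isLexCoding_uni.antisymm (Or.inr h) hba
  rw [this] at h
  exact uniLt_irrefl b h

/-! ### Images of infinite words under substitutions -/

/-- The image of the prefix of length `n`. -/
def prefixImage (f : Sub2) (a : W2) (n : ℕ) : List Bool :=
  listApply f (List.ofFn (fun i : Fin n => a i.val))

theorem prefixImage_succ (f : Sub2) (a : W2) (n : ℕ) :
    prefixImage f a (n + 1) = prefixImage f a n ++ f (a n) := by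
  rw [prefixImage, List.ofFn_succ_last]
  simp [prefixImage, listApply]

theorem prefixImage_mono (f : Sub2) (a : W2) {m n : ℕ} (h : m ≤ n) :
    prefixImage f a m <+: prefixImage f a n := by
  induction n, h using Nat.le_induction with
  | base => exact List.prefix_rfl
  | succ n _ ih =>
    rw [prefixImage_succ]
    exact ih.trans (List.prefix_append _ _)

theorem le_length_prefixImage {f : Sub2} (hf : ∀ b, f b ≠ []) (a : W2) (n : ℕ) :
    n ≤ (prefixImage f a n).length := by
  induction n with
  | zero => omega
  | succ n ih =>
    have := List.length_pos_iff.2 (hf (a n))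
    rw [prefixImage_succ, List.length_append]
    omega

theorem getD_eq_of_isPrefix {l l' : List Bool} (h : l <+: l') {n : ℕ} (hn : n < l.length) :
    l'.getD n false = l.getD n false := by
  obtain ⟨t, rfl⟩ := h
  exact List.getD_append _ _ _ _ hn

theorem subApply_length_add {f : Sub2} (hf : ∀ b, f b ≠ []) (a : W2) (n j : ℕ)
    (hj : j < (f (a n)).length) :
    subApply f a ((prefixImage f a n).length + j) = (f (a n)).getD j false := by
  set p := (prefixImage f a n).length + j with hp
  change (prefixImage f a (p + 1)).getD p false = _
  have h1 : p < (prefixImage f a (p + 1)).length := le_length_prefixImage hf a (p + 1)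
  have h2 : p < (prefixImage f a (n + 1)).length := by
    rw [prefixImage_succ, List.length_append]
    omega
  have h3 : (prefixImage f a (p + 1)).getD p false = (prefixImage f a (n + 1)).getD p false := by
    rcases le_total (p + 1) (n + 1) with h | h
    · exact (getD_eq_of_isPrefix (prefixImage_mono f a h) h1).symm
    · exact getD_eq_of_isPrefix (prefixImage_mono f a h) h2
  rw [h3, prefixImage_succ, List.getD_append_right _ _ _ _ (by omega), hp,
    Nat.add_sub_cancel_left]

/-! ### The period-doubling substitution -/

theorem pdSub_ne_nil (b : Bool) : pdSub b ≠ [] := by cases b <;> simp [pdSub]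

theorem length_prefixImage_pdSub (a : W2) (n : ℕ) : (prefixImage pdSub a n).length = 2 * n := by
  induction n with
  | zero => simp [prefixImage, listApply]
  | succ n ih =>
    rw [prefixImage_succ, List.length_append, ih]
    cases a n <;> simp [pdSub] <;> ring

theorem pd_even (a : W2) (n : ℕ) : subApply pdSub a (2 * n) = true := by
  have := subApply_length_add pdSub_ne_nil a n 0 (by cases a n <;> simp [pdSub])
  rw [length_prefixImage_pdSub] at this
  rw [← add_zero (2 * n), this]
  cases a n <;> rfl

theorem pd_odd (a : W2) (n : ℕ) : subApply pdSub a (2 * n + 1) = !a n := by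
  have := subApply_length_add pdSub_ne_nil a n 1 (by cases a n <;> simp [pdSub])
  rw [length_prefixImage_pdSub] at this
  rw [this]
  cases a n <;> rfl

theorem pd_injective : Function.Injective (subApply pdSub) := by
  intro a b h
  funext n
  have := congrFun h (2 * n + 1)
  simpa [pd_odd] using this

theorem eq_pd_of_even {s : W2} (h : ∀ n, s (2 * n) = true) :
    s = subApply pdSub (fun n => !s (2 * n + 1)) := by
  funext n
  rcases Nat.even_or_odd' n with ⟨k, rfl | rfl⟩
  · rw [h, pd_even]
  · simp [pd_odd]

theorem Agree.pd {a b : W2} {n : ℕ} (h : Agree n a b) :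
    Agree (2 * n + 1) (subApply pdSub a) (subApply pdSub b) := by
  intro i hi
  rcases Nat.even_or_odd' i with ⟨k, rfl | rfl⟩
  · rw [pd_even, pd_even]
  · rw [pd_odd, pd_odd, h k (by omega)]

theorem shiftn_pd (a : W2) (k : ℕ) :
    shiftn (subApply pdSub a) (2 * k) = subApply pdSub (shiftn a k) := by
  funext n
  rcases Nat.even_or_odd' n with ⟨j, rfl | rfl⟩
  · rw [pd_even, shiftn, ← mul_add, pd_even]
  · rw [pd_odd, shiftn, show 2 * j + 1 + 2 * k = 2 * (j + k) + 1 by ring, pd_odd, shiftn]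

theorem even_countP_pd (a : W2) (n : ℕ) :
    Even ((List.range (2 * n)).countP (fun m => subApply pdSub a m)) ↔
      Even ((List.range n).countP (fun m => a m)) := by
  induction n with
  | zero => simp
  | succ n ih =>
    rw [show 2 * (n + 1) = 2 * n + 1 + 1 by ring, countP_range_succ, countP_range_succ,
      countP_range_succ, pd_even, pd_odd]
    cases a n <;> simp [ih, Nat.even_add_one]

theorem uniLt.pd {a b : W2} (h : uniLt a b) :
    uniLt (subApply pdSub a) (subApply pdSub b) := by
  obtain ⟨n, hn, h⟩ := h
  refine ⟨2 * n + 1, Agree.pd hn, ?_⟩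
  rw [countP_range_succ, pd_even, pd_odd, pd_odd]
  by_cases he : Even ((List.range n).countP (fun m => a m))
  · rw [if_pos he] at h
    have : ¬ Even ((List.range (2 * n)).countP (fun m => subApply pdSub a m) + true.toNat) := by
      simpa [Nat.even_add_one, even_countP_pd] using he
    rw [if_neg this]
    simp [h]
  · rw [if_neg he] at h
    have : Even ((List.range (2 * n)).countP (fun m => subApply pdSub a m) + true.toNat) := by
      simpa [Nat.even_add_one, even_countP_pd] using he
    rw [if_pos this]
    simp [h]

theorem uniLe_pd_iff {a b : W2} :
    uniLe (subApply pdSub a) (subApply pdSub b) ↔ uniLe a b := by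
  constructor
  · intro h
    by_contra hc
    rcases isLexCoding_uni.total a b with h' | rfl | h'
    · exact hc h'
    · exact hc (Or.inl rfl)
    · exact h'.pd.not_uniLe h
  · rintro (rfl | h)
    · exact Or.inl rfl
    · exact Or.inr h.pd

/-! ### Shift-maximal words for the unimodal order -/

theorem uniLe_of_prefix_one_zero {s t : W2} (h0 : s 0 = true) (h1 : s 1 = false)
    (ht : t 0 = true → t 1 = true) : uniLe t s := by
  right
  cases h : t 0
  · exact uniLt_of_zero h h0
  · refine ⟨1, fun i hi => ?_, ?_⟩
    · rw [Nat.lt_one_iff.1 hi, h, h0]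
    · simp [List.range_succ, h, ht h, h1]

theorem eq_w0_of_head {s : W2} (hs : ∀ k, uniLe (shiftn s k) s) (h0 : s 0 = false) : s = w0 := by
  funext n
  by_contra hn
  have hn : s n = true := by simpa [w0] using hn
  exact (uniLt_of_zero h0 (b := shiftn s n) (by simpa [shiftn] using hn)).not_uniLe (hs n)

theorem eq_w1_of_head {s : W2} (hs : ∀ k, uniLe (shiftn s k) s) (h0 : s 0 = true)
    (h1 : s 1 = true) : s = w1 := by
  funext n
  change s n = true
  induction n with
  | zero => exact h0
  | succ n ih =>
    by_contra hn
    have hlt : uniLt s (shiftn s n) := by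
      refine ⟨1, fun i hi => ?_, ?_⟩
      · rw [Nat.lt_one_iff.1 hi, h0, shiftn, zero_add, ih]
      · simpa [List.range_succ, h0, h1, shiftn, add_comm] using hn
    exact hlt.not_uniLe (hs n)

theorem pd_mem_supWords {a : W2} (ha : a ∈ supWords uniLe) :
    subApply pdSub a ∈ supWords uniLe := by
  rw [isLexCoding_uni.mem_supWords_iff] at ha ⊢
  intro k
  cases h0 : a 0
  · have hw := eq_w0_of_head ha h0
    have h1 : subApply pdSub a = w1 := by
      funext n
      rcases Nat.even_or_odd' n with ⟨j, rfl | rfl⟩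
      · rw [pd_even, w1]
      · rw [pd_odd, hw, w1, w0, Bool.not_false]
    rw [h1]
    exact Or.inl rfl
  · rcases Nat.even_or_odd' k with ⟨j, rfl | rfl⟩
    · rw [shiftn_pd, uniLe_pd_iff]
      exact ha j
    · refine uniLe_of_prefix_one_zero (pd_even a 0) ((pd_odd a 0).trans (by rw [h0]; rfl))
        fun _ => ?_
      rw [shiftn, show 1 + (2 * j + 1) = 2 * (j + 1) by ring, pd_even]

/-- The period-doubling word. -/
def pdWord : W2 := fun n => decide (Even (padicValNat 2 (n + 1)))

theorem pdWord_even (n : ℕ) : pdWord (2 * n) = true := by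
  have : padicValNat 2 (2 * n + 1) = 0 := padicValNat.eq_zero_of_not_dvd (by omega)
  simp [pdWord, this]

theorem pdWord_odd (n : ℕ) : pdWord (2 * n + 1) = !pdWord n := by
  have : padicValNat 2 (2 * n + 1 + 1) = padicValNat 2 (n + 1) + 1 := by
    rw [show 2 * n + 1 + 1 = 2 * (n + 1) by ring,
      padicValNat.mul (by norm_num) (by omega), padicValNat.self (by norm_num), add_comm]
  simp only [pdWord, this, Nat.even_add_one, decide_not]

theorem pd_pdWord : subApply pdSub pdWord = pdWord := by
  funext n
  rcases Nat.even_or_odd' n with ⟨j, rfl | rfl⟩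
  · rw [pd_even, pdWord_even]
  · rw [pd_odd, pdWord_odd]

theorem pdWord_values : pdWord 0 = true ∧ pdWord 1 = false ∧ pdWord 2 = true ∧
    pdWord 3 = true ∧ pdWord 4 = true ∧ pdWord 5 = false := by
  have h0 := pdWord_even 0
  have h1 := pdWord_odd 0
  have h2 := pdWord_even 1
  have h3 := pdWord_odd 1
  have h4 := pdWord_even 2
  have h5 := pdWord_odd 2
  simp_all

/-- A word `1 0 1^{2k} 0 ⋯` is above the period-doubling word. -/
theorem pdWord_lt {t : W2} {k : ℕ} (h0 : t 0 = true) (h1 : t 1 = false)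
    (ht : ∀ i, 2 ≤ i → i < 2 * k + 2 → t i = true) (hk : t (2 * k + 2) = false) :
    uniLt pdWord t := by
  obtain ⟨m0, m1, m2, m3, m4, m5⟩ := pdWord_values
  rcases k with _ | _ | k
  · refine ⟨2, fun i hi => ?_, ?_⟩
    · interval_cases i <;> simp [*]
    · simpa [List.range_succ, m0, m1, m2] using hk
  · have t2 := ht 2 (by omega) (by omega)
    have t3 := ht 3 (by omega) (by omega)
    refine ⟨4, fun i hi => ?_, ?_⟩
    · interval_cases i <;> simp [*]
    · have : ¬ Even 3 := by decide
      simpa [List.range_succ, m0, m1, m2, m3, m4, this] using hk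
  · have t2 := ht 2 (by omega) (by omega)
    have t3 := ht 3 (by omega) (by omega)
    have t4 := ht 4 (by omega) (by omega)
    have t5 := ht 5 (by omega) (by omega)
    refine ⟨5, fun i hi => ?_, ?_⟩
    · interval_cases i <;> simp [*]
    · have : Even 4 := by decide
      simp [List.range_succ, m0, m1, m2, m3, m4, m5, this, t5]

theorem even_eq_true {s : W2} (hs : ∀ k, uniLe (shiftn s k) s) (h0 : s 0 = true)
    (hm : uniLe s pdWord) (n : ℕ) : s (2 * n) = true := by
  cases h1 : s 1
  · induction n using Nat.strong_induction_on with
    | _ n ih =>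
      by_contra hn
      have hn : s (2 * n) = false := by simpa using hn
      have hn0 : n ≠ 0 := by
        rintro rfl
        rw [mul_zero, h0] at hn
        exact Bool.noConfusion hn
      have hz : ∃ j, j < n ∧ s (2 * j + 1) = false := ⟨0, by omega, h1⟩
      obtain ⟨j, ⟨hj, hjs⟩, hmax⟩ : ∃ j, (j < n ∧ s (2 * j + 1) = false) ∧
          ∀ i, j < i → i < n → s (2 * i + 1) = true := by
        refine ⟨Nat.findGreatest (fun j => j < n ∧ s (2 * j + 1) = false) n,
          Nat.findGreatest_spec (P := fun j => j < n ∧ s (2 * j + 1) = false)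
            (Nat.zero_le n) ⟨by omega, h1⟩, fun i hi hin => ?_⟩
        have := Nat.findGreatest_is_greatest hi hin.le
        simpa [hin] using this
      have hlt : uniLt pdWord (shiftn s (2 * j)) := by
        refine pdWord_lt (k := n - j - 1) ?_ ?_ (fun i hi2 hi => ?_) ?_
        · simpa [shiftn] using ih j hj
        · simpa [shiftn, add_comm] using hjs
        · rcases Nat.even_or_odd' i with ⟨l, rfl | rfl⟩
          · rw [shiftn, ← mul_add]
            exact ih _ (by omega)
          · rw [shiftn, show 2 * l + 1 + 2 * j = 2 * (l + j) + 1 by ring]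
            exact hmax _ (by omega) (by omega)
        · rw [shiftn, show 2 * (n - j - 1) + 2 + 2 * j = 2 * n by omega]
          exact hn
      exact hlt.not_uniLe (isLexCoding_uni.trans (hs _) hm)
  · rw [eq_w1_of_head hs h0 h1, w1]

theorem exists_eq_iterate_pd {s : W2} (hs : s ∈ supWords uniLe) (hm : uniLe s pdWord)
    (hne : s ≠ pdWord) : ∃ n, s = (subApply pdSub)^[n] w0 := by
  obtain ⟨N, -, hN⟩ := exists_agree_ne hne
  clear hne
  rw [isLexCoding_uni.mem_supWords_iff] at hs
  induction N using Nat.strong_induction_on generalizing s with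
  | _ N ih =>
    cases h0 : s 0
    · exact ⟨0, eq_w0_of_head hs h0⟩
    · have hse := eq_pd_of_even (even_eq_true hs h0 hm)
      set s' : W2 := fun n => !s (2 * n + 1)
      rw [hse] at hs hm hN
      rw [← pd_pdWord] at hm hN
      rcases Nat.even_or_odd' N with ⟨j, rfl | rfl⟩
      · rw [pd_even, pd_even] at hN
        exact absurd rfl hN
      · rw [pd_odd, pd_odd] at hN
        obtain ⟨n, hn⟩ := ih j (by omega) (s := s')
          (fun k => uniLe_pd_iff.1 (by rw [← shiftn_pd]; exact hs (2 * k)))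
          (uniLe_pd_iff.1 hm) (fun h => hN (by rw [h]))
        exact ⟨n + 1, by rw [Function.iterate_succ_apply', ← hn, ← hse]⟩

theorem iterate_pd_mem_supWords (n : ℕ) : (subApply pdSub)^[n] w0 ∈ supWords uniLe := by
  induction n with
  | zero =>
    rw [isLexCoding_uni.mem_supWords_iff]
    exact fun k => Or.inl rfl
  | succ n ih =>
    rw [Function.iterate_succ_apply']
    exact pd_mem_supWords ih

theorem agree_iterate_pd (n : ℕ) : Agree n pdWord ((subApply pdSub)^[n] w0) := by
  induction n with
  | zero => exact fun i hi => absurd hi (by omega)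
  | succ n ih =>
    rw [Function.iterate_succ_apply', ← pd_pdWord]
    exact fun i hi => ih.pd i (by omega)

theorem iterate_pd_ne (n : ℕ) : (subApply pdSub)^[n] w0 ≠ pdWord := by
  induction n with
  | zero =>
    intro h
    have := congrFun h 0
    rw [pdWord_values.1] at this
    exact Bool.noConfusion this
  | succ n ih =>
    rw [Function.iterate_succ_apply', ← pd_pdWord]
    exact fun h => ih (pd_injective h)

theorem isSmallestAcc_uni : IsSmallestAcc uniLe (supWords uniLe) pdWord := by
  constructor
  · rw [isAccPt'_iff]
    exact fun n => ⟨_, iterate_pd_mem_supWords n, iterate_pd_ne n, agree_iterate_pd n⟩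
  · intro y hy
    rw [isAccPt'_iff] at hy
    by_contra hc
    have hle : uniLe y pdWord := (isLexCoding_uni.total _ _).resolve_left hc
    have hne : y ≠ pdWord := fun h => hc (Or.inl h.symm)
    obtain ⟨N, hN, hyN, hmN⟩ := isLexCoding_uni.exists_of_le_of_ne hle hne
    have hsep : ∀ n, ∃ K, (subApply pdSub)^[n] w0 ≠ y → ¬ Agree K y ((subApply pdSub)^[n] w0) := by
      intro n
      by_cases hn : (subApply pdSub)^[n] w0 = y
      · exact ⟨0, fun h => absurd hn h⟩
      · obtain ⟨K, -, hK⟩ := exists_agree_ne hn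
        exact ⟨K + 1, fun _ h => hK (h K (by omega)).symm⟩
    choose K hK using hsep
    obtain ⟨z, hz, hzy, hyz⟩ := hy (N + 1 + (Finset.range (N + 1)).sup K)
    have hyz' := (isLexCoding_uni.agree_iff y z _).2 hyz
    have hzm : uniLe z pdWord := isLexCoding_uni.le_of_agree (n := N)
      (fun i hi => (hyz' i (by omega)).symm.trans (hN i hi))
      ((hyz' N (by omega)).symm.trans hyN) hmN
    have hzne : Agree (N + 1) pdWord z → False := by
      intro h
      have := (isLexCoding_uni.agree_iff _ _ _).2 h N (by omega)
      rw [hmN, ← hyz' N (by omega), hyN] at this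
      exact Bool.noConfusion this
    obtain ⟨n, rfl⟩ := exists_eq_iterate_pd hz hzm (fun h => hzne (fun i _ => by rw [h]))
    have hn : n ∈ Finset.range (N + 1) := by
      by_contra hn
      rw [Finset.mem_range] at hn
      exact hzne fun i hi => agree_iterate_pd n i (by omega)
    have := Finset.le_sup (f := K) hn
    exact hK n hzy fun i hi => hyz i (by omega)

/-! ### The substitution `0 ↦ 1`, `1 ↦ 10` -/

theorem tauS_ne_nil (j k : ℕ) (b : Bool) : tauS j k b ≠ [] := by simp [tauS]

/-- The position at which the image of the `n`-th letter under `τ_{0,1}` starts. -/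
def tauPos (a : W2) (n : ℕ) : ℕ := (prefixImage (tauS 0 1) a n).length

theorem tauPos_zero (a : W2) : tauPos a 0 = 0 := by simp [tauPos, prefixImage, listApply]

theorem tauPos_succ (a : W2) (n : ℕ) : tauPos a (n + 1) = tauPos a n + 1 + (a n).toNat := by
  rw [tauPos, prefixImage_succ, List.length_append, ← tauPos]
  cases a n <;> simp [tauS, add_assoc]

theorem tau_tauPos (a : W2) (n : ℕ) : subApply (tauS 0 1) a (tauPos a n) = true := by
  have := subApply_length_add (tauS_ne_nil 0 1) a n 0 (by simp [tauS])
  rw [add_zero] at this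
  rw [tauPos, this]
  simp [tauS]

theorem tau_tauPos_add_one (a : W2) (n : ℕ) :
    subApply (tauS 0 1) a (tauPos a n + 1) = !a n := by
  cases h : a n
  · have := tau_tauPos a (n + 1)
    rwa [tauPos_succ, h] at this
  · have := subApply_length_add (tauS_ne_nil 0 1) a n 1 (by simp [tauS, h])
    rw [tauPos, this]
    simp [tauS, h]

theorem exists_tauPos (a : W2) (p : ℕ) :
    ∃ n, p = tauPos a n ∨ (p = tauPos a n + 1 ∧ a n = true) := by
  induction p with
  | zero => exact ⟨0, Or.inl (tauPos_zero a).symm⟩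
  | succ p ih =>
    obtain ⟨n, rfl | ⟨rfl, hn⟩⟩ := ih
    · cases h : a n
      · exact ⟨n + 1, Or.inl (by rw [tauPos_succ, h]; rfl)⟩
      · exact ⟨n, Or.inr ⟨rfl, h⟩⟩
    · exact ⟨n + 1, Or.inl (by rw [tauPos_succ, hn]; rfl)⟩

theorem tauPos_le (a : W2) (n : ℕ) : tauPos a n ≤ 2 * n := by
  induction n with
  | zero => simp [tauPos_zero]
  | succ n ih =>
    have := Bool.toNat_le (a n)
    rw [tauPos_succ]
    omega

theorem Agree.tauPos {a b : W2} {n : ℕ} (h : Agree n a b) : tauPos a n = tauPos b n := by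
  induction n with
  | zero => rw [tauPos_zero, tauPos_zero]
  | succ n ih =>
    rw [tauPos_succ, tauPos_succ, ih fun i hi => h i (by omega), h n (by omega)]

theorem Agree.subApply {f : Sub2} {a b : W2} {n : ℕ} (h : Agree n a b) :
    Agree n (subApply f a) (subApply f b) := by
  intro i hi
  have : (fun j : Fin (i + 1) => a j.val) = fun j : Fin (i + 1) => b j.val := by
    funext j
    exact h j (by omega)
  simp only [_root_.subApply, this]

theorem agree_tauPos {a b : W2} {n : ℕ} (h : Agree n a b) :
    Agree (tauPos a n + 1) (subApply (tauS 0 1) a) (subApply (tauS 0 1) b) := by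
  intro i hi
  obtain ⟨k, hk⟩ := exists_tauPos a i
  have hmono : Monotone (tauPos a) :=
    monotone_nat_of_le_succ fun n => by rw [tauPos_succ]; omega
  have hkn : k ≤ n := by
    by_contra! hc
    have := hmono (Nat.succ_le_of_lt hc)
    rw [Nat.succ_eq_add_one, tauPos_succ] at this
    omega
  have hp := Agree.tauPos (fun i hi => h i (by omega) : Agree k a b)
  rcases hk with rfl | ⟨rfl, hk⟩
  · rw [tau_tauPos, hp, tau_tauPos]
  · have hkn' : k < n := by
      by_contra! hc
      obtain rfl := le_antisymm hkn hc
      omega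
    rw [tau_tauPos_add_one, hp, tau_tauPos_add_one, h k hkn']

theorem agree_of_agree_tau {a b : W2} {n : ℕ}
    (h : Agree (2 * n) (subApply (tauS 0 1) a) (subApply (tauS 0 1) b)) : Agree n a b := by
  intro i
  induction i using Nat.strong_induction_on with
  | _ i ih =>
    intro hi
    have hp := Agree.tauPos (fun j hj => ih j hj (by omega) : Agree i a b)
    have hle := tauPos_le a i
    have := h (tauPos a i + 1) (by omega)
    rw [tau_tauPos_add_one, hp, tau_tauPos_add_one] at this
    simpa using this

theorem tau_injective : Function.Injective (subApply (tauS 0 1)) := by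
  intro a b h
  funext n
  exact agree_of_agree_tau (n := n + 1) (fun i _ => by rw [h]) n (by omega)

theorem countP_tau (a : W2) (n : ℕ) :
    (List.range (tauPos a n)).countP (fun m => subApply (tauS 0 1) a m) = n := by
  induction n with
  | zero => simp [tauPos_zero]
  | succ n ih =>
    rw [tauPos_succ]
    cases h : a n
    · simp [countP_range_succ, ih, tau_tauPos]
    · have h1 := tau_tauPos_add_one a n
      rw [Bool.toNat_true, countP_range_succ, countP_range_succ, ih, tau_tauPos, h1, h]
      rfl

theorem altLt.tau {a b : W2} (h : altLt a b) :
    uniLt (subApply (tauS 0 1) a) (subApply (tauS 0 1) b) := by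
  obtain ⟨n, hn, h⟩ := h
  refine ⟨tauPos a n + 1, agree_tauPos hn, ?_⟩
  have hb := tau_tauPos_add_one b n
  rw [← Agree.tauPos hn] at hb
  rw [countP_range_succ, countP_tau, tau_tauPos, tau_tauPos_add_one, hb]
  by_cases he : Even n <;> simp only [he, if_true, if_false] at h <;>
    simp [Nat.even_add_one, he, h]

theorem uniLe_tau_iff {a b : W2} :
    uniLe (subApply (tauS 0 1) a) (subApply (tauS 0 1) b) ↔ altLe a b := by
  constructor
  · intro h
    by_contra hc
    rcases isLexCoding_alt.total a b with h' | rfl | h'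
    · exact hc h'
    · exact hc (Or.inl rfl)
    · exact h'.tau.not_uniLe h
  · rintro (rfl | h)
    · exact Or.inl rfl
    · exact Or.inr h.tau

theorem tauPos_shiftn (a : W2) (k n : ℕ) :
    tauPos (shiftn a k) n + tauPos a k = tauPos a (n + k) := by
  induction n with
  | zero => simp [tauPos_zero]
  | succ n ih =>
    rw [tauPos_succ, show n + 1 + k = n + k + 1 by ring, tauPos_succ, ← ih, shiftn]
    ring

theorem shiftn_tau (a : W2) (k : ℕ) :
    shiftn (subApply (tauS 0 1) a) (tauPos a k) = subApply (tauS 0 1) (shiftn a k) := by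
  funext p
  obtain ⟨n, rfl | ⟨rfl, -⟩⟩ := exists_tauPos (shiftn a k) p
  · rw [tau_tauPos, shiftn, tauPos_shiftn, tau_tauPos]
  · rw [tau_tauPos_add_one, shiftn, add_right_comm, tauPos_shiftn, tau_tauPos_add_one, shiftn]

theorem tau_mem_supWords_iff {a : W2} :
    subApply (tauS 0 1) a ∈ supWords uniLe ↔ a ∈ supWords altLe := by
  rw [isLexCoding_uni.mem_supWords_iff, isLexCoding_alt.mem_supWords_iff]
  constructor
  · intro h k
    rw [← uniLe_tau_iff, ← shiftn_tau]
    exact h _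
  · intro h p
    obtain ⟨n, rfl | ⟨rfl, hn⟩⟩ := exists_tauPos a p
    · rw [shiftn_tau, uniLe_tau_iff]
      exact h n
    · refine Or.inr (uniLt_of_zero ?_ ?_)
      · rw [shiftn, zero_add, tau_tauPos_add_one, hn, Bool.not_true]
      · simpa [tauPos_zero] using tau_tauPos a 0

/-- The positions of the successive ones in a word starting with `1` and avoiding `00`. -/
def onePos (s : W2) : ℕ → ℕ
  | 0 => 0
  | n + 1 => onePos s n + 1 + (!s (onePos s n + 1)).toNat

theorem exists_tau_eq {s : W2} (h0 : s 0 = true)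
    (h : ∀ n, s n = true ∨ s (n + 1) = true) : ∃ a, subApply (tauS 0 1) a = s := by
  let a : W2 := fun n => !s (onePos s n + 1)
  have hpos : ∀ n, tauPos a n = onePos s n := by
    intro n
    induction n with
    | zero => rw [tauPos_zero, onePos]
    | succ n ih => rw [tauPos_succ, ih, onePos]
  have hone : ∀ n, s (onePos s n) = true := by
    intro n
    induction n with
    | zero => rwa [onePos]
    | succ n ih =>
      rw [onePos]
      cases hs : s (onePos s n + 1)
      · exact (h (onePos s n + 1)).resolve_left (by simp [hs])
      · exact hs
  refine ⟨a, ?_⟩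
  funext p
  obtain ⟨n, rfl | ⟨rfl, -⟩⟩ := exists_tauPos a p
  · rw [tau_tauPos, hpos, hone]
  · rw [tau_tauPos_add_one, hpos, Bool.not_not]

theorem exists_tau_eq_pd (s : W2) : ∃ a, subApply (tauS 0 1) a = subApply pdSub s := by
  refine exists_tau_eq (pd_even s 0) fun n => ?_
  rcases Nat.even_or_odd' n with ⟨k, rfl | rfl⟩
  · exact Or.inl (pd_even s k)
  · exact Or.inr (pd_even s (k + 1))

theorem isSmallestAcc_alt {m : W2} (hm : subApply (tauS 0 1) m = pdWord) :
    IsSmallestAcc altLe (supWords altLe) m := by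
  constructor
  · rw [isAccPt'_iff]
    intro n
    obtain ⟨a, ha⟩ := exists_tau_eq_pd ((subApply pdSub)^[2 * n] w0)
    rw [← Function.iterate_succ_apply' (subApply pdSub)] at ha
    refine ⟨a, ?_, ?_, agree_of_agree_tau ?_⟩
    · rw [← tau_mem_supWords_iff, ha]
      exact iterate_pd_mem_supWords _
    · intro h
      exact iterate_pd_ne _ (by rw [← ha, h, hm])
    · rw [ha, hm]
      exact fun i hi => agree_iterate_pd _ i (by omega)
  · intro y hy
    rw [← uniLe_tau_iff, hm]
    refine isSmallestAcc_uni.2 _ ?_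
    rw [isAccPt'_iff] at hy ⊢
    intro n
    obtain ⟨z, hz, hne, hyz⟩ := hy n
    exact ⟨_, tau_mem_supWords_iff.2 hz, fun h => hne (tau_injective h), hyz.subApply⟩

/-- The unimodal order is a cylinder order whose smallest accumulation
point `m_uni` equals `τ_{0,1}(m_alt)`, the fixed point of the period-doubling
substitution `0 ↦ 11, 1 ↦ 10`. -/
theorem stmt_12 :
    IsCylOrder uniLe ∧
      ∃ mAlt mUni : W2, IsSmallestAcc altLe (supWords altLe) mAlt ∧
        IsSmallestAcc uniLe (supWords uniLe) mUni ∧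
        mUni = subApply (tauS 0 1) mAlt ∧ mUni = subApply pdSub mUni := by
  obtain ⟨m, hm⟩ := exists_tau_eq_pd pdWord
  rw [pd_pdWord] at hm
  exact ⟨isLexCoding_uni.isCylOrder, m, pdWord, isSmallestAcc_alt hm, isSmallestAcc_uni,
    hm.symm, pd_pdWord.symm⟩
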